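/- Suppose given spaces W, X, Y over a base space B with fibrewise maps W → X, W → Y, and a map f : X → Y over B and under W such that: (1) for each b ∈ B the restriction f| : X_b → Y_b is a homotopy equivalence; (2) B admits a numerable cover {V_λ} for which each inclusion V_λ ↪ B is nullhomotopic; (3) X → B and Y → B are Dold fibrations; (4) W → X and W → Y are fibrewise cofibrations. Then f is a homotopy equivalence over B and under W, i.e. it admits a homotopy inverse over B and under W, with all homotopies through maps over B and under W. -/

import Mathlib

/-- `p : X → B` is a Dold fibration: it has the weak covering homotopy property.  Any
homotopy into `B` with an initial lift can be lifted, after changing the initial lift by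
a vertical homotopy. -/
def IsDoldFibration {B X : Type} [TopologicalSpace B] [TopologicalSpace X]
    (p : C(X, B)) : Prop :=
  ∀ (A : Type) [TopologicalSpace A] (F : C(A × unitInterval, B)) (g₀ : C(A, X)),
    (∀ a, p (g₀ a) = F (a, 0)) →
    ∃ g : C(A × unitInterval, X),
      (∀ a t, p (g (a, t)) = F (a, t)) ∧
      ∃ K : C(A × unitInterval, X),
        (∀ a t, p (K (a, t)) = F (a, 0)) ∧
        (∀ a, K (a, 0) = g (a, 0)) ∧ (∀ a, K (a, 1) = g₀ a)

/-- A map of spaces over `B` is a fibrewise cofibration if it is a map over `B` with the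
fibrewise homotopy extension property. -/
def IsFibrewiseCofibration {B W X : Type} [TopologicalSpace B] [TopologicalSpace W]
    [TopologicalSpace X] (r : C(W, B)) (p : C(X, B)) (w : C(W, X)) : Prop :=
  (∀ a, p (w a) = r a) ∧
  ∀ (E : Type) [TopologicalSpace E] (e : C(E, B)) (F₀ : C(X, E))
    (H : C(W × unitInterval, E)),
    (∀ x, e (F₀ x) = p x) → (∀ a t, e (H (a, t)) = r a) → (∀ a, H (a, 0) = F₀ (w a)) →
    ∃ G : C(X × unitInterval, E),
      (∀ x t, e (G (x, t)) = p x) ∧ (∀ x, G (x, 0) = F₀ x) ∧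
      ∀ a t, G (w a, t) = H (a, t)

/-- `f` is a homotopy equivalence over `B` and under `W`: it admits a homotopy inverse
over `B` and under `W`, with all homotopies through maps over `B` and under `W`. -/
def IsHtpyEquivOverUnder {B W X Y : Type} [TopologicalSpace B] [TopologicalSpace W]
    [TopologicalSpace X] [TopologicalSpace Y]
    (p : C(X, B)) (q : C(Y, B)) (w₁ : C(W, X)) (w₂ : C(W, Y)) (f : C(X, Y)) : Prop :=
  (∀ x, q (f x) = p x) ∧ (∀ a, f (w₁ a) = w₂ a) ∧
  ∃ g : C(Y, X), (∀ y, p (g y) = q y) ∧ (∀ a, g (w₂ a) = w₁ a) ∧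
    (∃ K : C(X × unitInterval, X),
      (∀ x t, p (K (x, t)) = p x) ∧ (∀ a t, K (w₁ a, t) = w₁ a) ∧
      (∀ x, K (x, 0) = g (f x)) ∧ (∀ x, K (x, 1) = x)) ∧
    (∃ L : C(Y × unitInterval, Y),
      (∀ y t, q (L (y, t)) = q y) ∧ (∀ a t, L (w₂ a, t) = w₂ a) ∧
      (∀ y, L (y, 0) = f (g y)) ∧ (∀ y, L (y, 1) = y))


namespace DoldAux

open unitInterval

section basics
variable {A A' X Y B C : Type} [TopologicalSpace A] [TopologicalSpace A'] [TopologicalSpace X]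
  [TopologicalSpace Y] [TopologicalSpace B] [TopologicalSpace C]

/-- time slice of a homotopy -/
def sl (G : C(A × I, X)) (t : I) : C(A, X) := ⟨fun a => G (a, t), by fun_prop⟩

@[simp] theorem sl_apply (G : C(A × I, X)) (t : I) (a : A) : sl G t a = G (a, t) := rfl

/-- clamping to the unit interval -/
noncomputable def cl (x : ℝ) : I := Set.projIcc 0 1 zero_le_one x

@[fun_prop] theorem cl_cont : Continuous cl :=
  continuous_projIcc (h := zero_le_one)

theorem cl_zero {x : ℝ} (h : x ≤ 0) : cl x = 0 := Set.projIcc_of_le_left _ h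
theorem cl_one {x : ℝ} (h : 1 ≤ x) : cl x = 1 := Set.projIcc_of_right_le _ h
theorem cl_coe (t : I) : cl (t : ℝ) = t := Set.projIcc_val _ t

theorem conc (K K' : C(A × I, X)) (h : ∀ a, K (a, 1) = K' (a, 0)) :
    ∃ M : C(A × I, X), (∀ a (t : I), (t : ℝ) ≤ 1 / 2 → M (a, t) = K (a, cl (2 * t))) ∧
      (∀ a (t : I), 1 / 2 ≤ (t : ℝ) → M (a, t) = K' (a, cl (2 * t - 1))) := by
  have e : ∀ x : A × I, (x.2 : ℝ) = 1 / 2 →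
      K (x.1, cl (2 * x.2)) = K' (x.1, cl (2 * x.2 - 1)) := by
    intro x hx
    rw [cl_one (by linarith), cl_zero (by linarith), h]
  refine ⟨⟨fun x => if (x.2 : ℝ) ≤ 1 / 2 then K (x.1, cl (2 * x.2)) else
    K' (x.1, cl (2 * x.2 - 1)), ?_⟩, ?_, ?_⟩
  · exact Continuous.if_le (by fun_prop) (by fun_prop) (by fun_prop) (by fun_prop) e
  · intro a t ht
    simp only [ContinuousMap.coe_mk, if_pos ht]
  · intro a t ht
    simp only [ContinuousMap.coe_mk]
    split_ifs with h1
    · exact e (a, t) (le_antisymm h1 ht)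
    · rfl

/-- vertical homotopy rel `S` -/
def VH (p : C(X, B)) (S : Set A) (φ ψ : C(A, X)) : Prop :=
  ∃ K : C(A × I, X), (∀ a, K (a, 0) = φ a) ∧ (∀ a, K (a, 1) = ψ a) ∧
    (∀ a t, p (K (a, t)) = p (φ a)) ∧ ∀ a ∈ S, ∀ t, K (a, t) = φ a

theorem VH.refl (p : C(X, B)) (S : Set A) (φ : C(A, X)) : VH p S φ φ :=
  ⟨⟨fun x => φ x.1, by fun_prop⟩, by simp, by simp, by simp, by simp⟩

theorem VH.over {p : C(X, B)} {S : Set A} {φ ψ : C(A, X)} (h : VH p S φ ψ) (a : A) :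
    p (ψ a) = p (φ a) := by
  obtain ⟨K, h0, h1, h2, -⟩ := h
  rw [← h1, h2]

theorem VH.symm {p : C(X, B)} {S : Set A} {φ ψ : C(A, X)} (h : VH p S φ ψ) : VH p S ψ φ := by
  have ho := h.over
  obtain ⟨K, h0, h1, h2, h3⟩ := h
  refine ⟨⟨fun x => K (x.1, σ x.2), by fun_prop⟩, ?_, ?_, ?_, ?_⟩
  · intro a; simp [h1]
  · intro a; simp [h0]
  · intro a t; simp [h2, ho]
  · intro a ha t
    have : ψ a = φ a := by rw [← h1, h3 a ha]
    simp [h3 a ha, this]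

theorem VH.trans {p : C(X, B)} {S : Set A} {φ ψ χ : C(A, X)} (h : VH p S φ ψ)
    (h' : VH p S ψ χ) : VH p S φ χ := by
  have ho := h.over
  obtain ⟨K, h0, h1, h2, h3⟩ := h
  obtain ⟨K', h0', h1', h2', h3'⟩ := h'
  obtain ⟨M, m1, m2⟩ := conc K K' (by intro a; rw [h1, h0'])
  refine ⟨M, ?_, ?_, ?_, ?_⟩
  · intro a; rw [m1 a 0 (by norm_num), cl_zero (by simp), h0]
  · intro a; rw [m2 a 1 (by norm_num), cl_one (by norm_num), h1']
  · intro a t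
    rcases le_total (t : ℝ) (1 / 2) with ht | ht
    · rw [m1 a t ht, h2]
    · rw [m2 a t ht, h2', ho]
  · intro a ha t
    have : ψ a = φ a := by rw [← h1, h3 a ha]
    rcases le_total (t : ℝ) (1 / 2) with ht | ht
    · rw [m1 a t ht, h3 a ha]
    · rw [m2 a t ht, h3' a ha, this]

theorem VH.post {p : C(X, B)} {S : Set A} {φ ψ : C(A, X)} (h : VH p S φ ψ) (q : C(Y, C))
    (f : C(X, Y)) (hf : ∀ x x', p x = p x' → q (f x) = q (f x')) :
    VH q S (f.comp φ) (f.comp ψ) := by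
  obtain ⟨K, h0, h1, h2, h3⟩ := h
  refine ⟨f.comp K, ?_, ?_, ?_, ?_⟩
  · intro a; simp [h0]
  · intro a; simp [h1]
  · intro a t; simp only [ContinuousMap.comp_apply]; exact hf _ _ (h2 a t)
  · intro a ha t; simp [h3 a ha]

theorem VH.pre {p : C(X, B)} {S : Set A} {φ ψ : C(A, X)} (h : VH p S φ ψ) (f : C(A', A))
    (S' : Set A') (hS : ∀ a ∈ S', f a ∈ S) : VH p S' (φ.comp f) (ψ.comp f) := by
  obtain ⟨K, h0, h1, h2, h3⟩ := h
  refine ⟨⟨fun x => K (f x.1, x.2), by fun_prop⟩, ?_, ?_, ?_, ?_⟩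
  · intro a; simp [h0]
  · intro a; simp [h1]
  · intro a t; simp [h2]
  · intro a ha t; simp [h3 _ (hS a ha)]

/-- going around three sides of a square -/
theorem VH.square {p : C(X, B)} {S : Set A} (Q : C((A × I) × I, X)) (u : A → B)
    (h0 : ∀ a t, p (Q ((a, 0), t)) = u a) (h1 : ∀ a t, p (Q ((a, 1), t)) = u a)
    (h2 : ∀ a s, p (Q ((a, s), 1)) = u a) (v : A → X)
    (k0 : ∀ a ∈ S, ∀ t, Q ((a, 0), t) = v a) (k1 : ∀ a ∈ S, ∀ t, Q ((a, 1), t) = v a)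
    (k2 : ∀ a ∈ S, ∀ s, Q ((a, s), 1) = v a) :
    VH p S (sl (sl Q 0) 0) (sl (sl Q 0) 1) := by
  have a1 : VH p S (sl (sl Q 0) 0) (sl (sl Q 1) 0) := by
    refine ⟨⟨fun x => Q ((x.1, 0), x.2), by fun_prop⟩, ?_, ?_, ?_, ?_⟩ <;> intros <;>
      simp only [ContinuousMap.coe_mk, sl_apply, *]
  have a2 : VH p S (sl (sl Q 1) 0) (sl (sl Q 1) 1) := by
    refine ⟨⟨fun x => Q ((x.1, x.2), 1), by fun_prop⟩, ?_, ?_, ?_, ?_⟩ <;> intros <;>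
      simp only [ContinuousMap.coe_mk, sl_apply, *]
  have a3 : VH p S (sl (sl Q 0) 1) (sl (sl Q 1) 1) := by
    refine ⟨⟨fun x => Q ((x.1, 1), x.2), by fun_prop⟩, ?_, ?_, ?_, ?_⟩ <;> intros <;>
      simp only [ContinuousMap.coe_mk, sl_apply, *]
  exact (a1.trans a2).trans a3.symm

/-- relative Dold fibration: lifting of homotopies which are vertical for `e` -/
def RD (e : C(B, C)) (p : C(X, B)) : Prop :=
  ∀ (A : Type) [TopologicalSpace A] (F : C(A × I, B)) (g₀ : C(A, X)),
    (∀ a t, e (F (a, t)) = e (F (a, 0))) →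
    (∀ a, p (g₀ a) = F (a, 0)) →
    ∃ g : C(A × I, X), (∀ a t, p (g (a, t)) = F (a, t)) ∧ VH p ∅ (sl g 0) g₀

theorem RD.of_dold {p : C(X, B)} (h : IsDoldFibration p) (e : C(B, C)) : RD e p := by
  intro A _ F g₀ _ h0
  obtain ⟨g, hg, K, k1, k2, k3⟩ := h A F g₀ h0
  exact ⟨g, hg, K, k2, k3, by intro a t; rw [k1]; simp [hg], by simp⟩

theorem conc_over {p : C(X, B)} (u : A × I → B) (K K' : C(A × I, X)) (c c' : C(I, I))
    (h : ∀ a, K (a, 1) = K' (a, 0)) (hc : c 1 = c' 0) (hK : ∀ a t, p (K (a, t)) = u (a, c t))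
    (hK' : ∀ a t, p (K' (a, t)) = u (a, c' t)) :
    ∃ (M : C(A × I, X)) (d : C(I, I)), d 0 = c 0 ∧ d 1 = c' 1 ∧ (∀ a, M (a, 0) = K (a, 0)) ∧
      (∀ a, M (a, 1) = K' (a, 1)) ∧ ∀ a t, p (M (a, t)) = u (a, d t) := by
  obtain ⟨M, m1, m2⟩ := conc K K' h
  obtain ⟨D, d1, d2⟩ := conc (A := Unit) ⟨fun x => c x.2, by fun_prop⟩ ⟨fun x => c' x.2, by fun_prop⟩
    (by intro a; simpa using hc)
  refine ⟨M, ⟨fun t => D ((), t), by fun_prop⟩, ?_, ?_, ?_, ?_, ?_⟩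
  · simp only [ContinuousMap.coe_mk]
    rw [d1 () 0 (by norm_num), cl_zero (by simp)]; rfl
  · simp only [ContinuousMap.coe_mk]
    rw [d2 () 1 (by norm_num), cl_one (by norm_num)]; rfl
  · intro a; rw [m1 a 0 (by norm_num), cl_zero (by simp)]
  · intro a; rw [m2 a 1 (by norm_num), cl_one (by norm_num)]
  · intro a t
    simp only [ContinuousMap.coe_mk]
    rcases le_total (t : ℝ) (1 / 2) with ht | ht
    · rw [m1 a t ht, d1 () t ht, hK]; rfl
    · rw [m2 a t ht, d2 () t ht, hK']; rfl

theorem transport {e : C(B, C)} {p : C(X, B)} (hp : RD e p) (G G' : C(A × I, X))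
    (hGG : ∀ a t, p (G (a, t)) = p (G' (a, t)))
    (he : ∀ a t, e (p (G (a, t))) = e (p (G (a, 0))))
    (h0 : VH p ∅ (sl G 0) (sl G' 0)) : VH p ∅ (sl G 1) (sl G' 1) := by
  obtain ⟨k, k0, k1, k2, -⟩ := h0
  set u : C(A × I, B) := p.comp G with hu
  obtain ⟨M, d, e1, e2, e3, e4, e5⟩ := conc_over (p := p) u k G' (ContinuousMap.const I 0)
    (ContinuousMap.id I) (by intro a; rw [k1]; rfl) rfl (by intro a t; rw [k2]; rfl)
    (by intro a t; rw [← hGG]; rfl)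
  obtain ⟨N, c, f1, f2, f3, f4, f5⟩ := conc_over (p := p) u
    ⟨fun x => G (x.1, σ x.2), by fun_prop⟩ M ⟨fun t => σ t, by fun_prop⟩ d
    (by intro a; simp [e3, k0]) (by simp [e1]) (by intro a t; rfl) e5
  have c0 : c 0 = 1 := by rw [f1]; simp
  have c1 : c 1 = 1 := by rw [f2, e2]; simp
  obtain ⟨Q, q1, q2⟩ := hp (A × I) ⟨fun x => u (x.1.1, max (c x.1.2) x.2), by fun_prop⟩ N
    (by intro a t; simp only [hu, ContinuousMap.coe_mk, ContinuousMap.comp_apply]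
        rw [he, he a.1 (max _ 0)])
    (by rintro ⟨a, s⟩; simp [f5])
  have mx : ∀ t : I, max 1 t = 1 := fun t => max_eq_left t.2.2
  have mx' : ∀ t : I, max t 1 = 1 := fun t => max_eq_right t.2.2
  have sq := VH.square (p := p) (S := ∅) Q (fun a => u (a, 1)) (by intro a t; simp [q1, c0, mx])
    (by intro a t; simp [q1, c1, mx]) (by intro a t; simp [q1, mx']) (fun a => G (a, 1))
    (by simp) (by simp) (by simp)
  have b0 := q2.pre (A' := A) ⟨fun a => (a, 0), by fun_prop⟩ ∅ (by simp)
  have b1 := q2.pre (A' := A) ⟨fun a => (a, 1), by fun_prop⟩ ∅ (by simp)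
  have E0 : sl G 1 = N.comp ⟨fun a => (a, 0), by fun_prop⟩ := by
    ext a; simp [f3]
  have E1 : sl G' 1 = N.comp ⟨fun a => (a, 1), by fun_prop⟩ := by
    ext a; simp [f4, e4]
  rw [E0, E1]
  exact (b0.symm.trans sq).trans b1

theorem transport' {e : C(B, C)} {p : C(X, B)} (hp : RD e p) (G G' : C(A × I, X))
    (hGG : ∀ a t, p (G (a, t)) = p (G' (a, t)))
    (he : ∀ a t, e (p (G (a, t))) = e (p (G (a, 0))))
    (h0 : VH p ∅ (sl G 1) (sl G' 1)) : VH p ∅ (sl G 0) (sl G' 0) := by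
  have := transport hp ⟨fun x => G (x.1, σ x.2), by fun_prop⟩
    ⟨fun x => G' (x.1, σ x.2), by fun_prop⟩ (by intro a t; exact hGG _ _)
    (by intro a t; simp only [ContinuousMap.coe_mk]; rw [he, he a (σ 0)])
    (by convert h0 using 1 <;> (ext a; simp))
  convert this using 1 <;> (ext a; simp)

end basics

section under
variable {B W X Y : Type} [TopologicalSpace B] [TopologicalSpace W]
    [TopologicalSpace X] [TopologicalSpace Y]

theorem VH.mono {A : Type} [TopologicalSpace A] {p : C(X, B)} {S S' : Set A} {φ ψ : C(A, X)}
    (h : VH p S φ ψ) (hS : S' ⊆ S) : VH p S' φ ψ := by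
  obtain ⟨K, h0, h1, h2, h3⟩ := h
  exact ⟨K, h0, h1, h2, fun a ha => h3 a (hS ha)⟩

/-- space of vertical paths -/
abbrev VPath (p : C(X, B)) : Type := {γ : C(I, X) // ∀ t, p (γ t) = p (γ 0)}

theorem hep_I {r : C(W, B)} {p : C(X, B)} {w : C(W, X)} (hw : IsFibrewiseCofibration r p w)
    (M : C(X × I, X)) (P : C((W × I) × I, X)) (hM : ∀ x t, p (M (x, t)) = p x)
    (hP : ∀ a t u, p (P ((a, t), u)) = r a) (hPM : ∀ a t, P ((a, t), 0) = M (w a, t)) :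
    ∃ Q : C((X × I) × I, X), (∀ x t u, p (Q ((x, t), u)) = p x) ∧
      (∀ x t, Q ((x, t), 0) = M (x, t)) ∧ ∀ a t u, Q ((w a, t), u) = P ((a, t), u) := by
  let e : C(VPath p, B) := ⟨fun γ => p (γ.1 0), by fun_prop⟩
  let F₀ : C(X, VPath p) := ⟨fun x => ⟨M.curry x, by intro t; simp [hM]⟩,
    Continuous.subtype_mk (by fun_prop) (fun x t => by simp [hM])⟩
  let P' : C((W × I) × I, X) := ⟨fun z => P ((z.1.1, z.2), z.1.2), by fun_prop⟩
  let H : C(W × I, VPath p) := ⟨fun y => ⟨P'.curry y, by intro t; simp [P', hP]⟩,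
    Continuous.subtype_mk (by fun_prop) (fun x t => by simp [P', hP])⟩
  obtain ⟨G, g1, g2, g3⟩ := hw.2 (VPath p) e F₀ H
    (by intro x; simp [e, F₀, hM]) (by intro a t; simp [e, H, P', hP])
    (by intro a; apply Subtype.ext; ext t; simp [H, F₀, P', hPM])
  refine ⟨⟨fun z => (G (z.1.1, z.2)).1 z.1.2, by fun_prop⟩, ?_, ?_, ?_⟩
  · intro x t u
    have := g1 x u
    simp only [ContinuousMap.coe_mk] at this ⊢
    rw [(G (x, u)).2 t, ← this]; rfl
  · intro x t; simp [g2, F₀]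
  · intro a t u; simp [g3, H, P']

theorem under_left {r : C(W, B)} {p : C(X, B)} {w : C(W, X)} (hw : IsFibrewiseCofibration r p w)
    (φ : C(X, X)) (hφw : ∀ a, φ (w a) = w a)
    (h : VH p ∅ φ (ContinuousMap.id X)) :
    ∃ ψ : C(X, X), (∀ x, p (ψ x) = p x) ∧ (∀ a, ψ (w a) = w a) ∧
      VH p (Set.range w) (ψ.comp φ) (ContinuousMap.id X) := by
  have hφ : ∀ x, p (φ x) = p x := fun x => (h.over x).symm
  obtain ⟨H, h0, h1, h2, -⟩ := h
  simp only [ContinuousMap.id_apply, hφ] at h1 h2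
  obtain ⟨G, g1, g2, g3⟩ := hw.2 X p (ContinuousMap.id X) ⟨fun y => H (w y.1, y.2), by fun_prop⟩
    (by simp) (by intro a t; simp [h2, hw.1]) (by intro a; simp [h0, hφw])
  simp only [ContinuousMap.id_apply, ContinuousMap.coe_mk] at g2 g3
  obtain ⟨M, m1, m2⟩ := conc (A := X) ⟨fun y => G (φ y.1, σ y.2), by fun_prop⟩ H
    (by intro a; simp [g2, h0])
  have mx : ∀ t : I, max 1 t = 1 := fun t => max_eq_left t.2.2
  have mx' : ∀ t : I, max t 1 = 1 := fun t => max_eq_right t.2.2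
  have mw : ∀ a t, M (w a, t) = H (w a, cl |2 * t - 1|) := by
    intro a t
    rcases le_total (t : ℝ) (1 / 2) with ht | ht
    · rw [m1 _ _ ht, abs_of_nonpos (by linarith)]
      simp only [ContinuousMap.coe_mk, hφw, g3]
      congr 2
      have h' : cl (2 * (t : ℝ)) = ⟨2 * t, by have := t.2.1; constructor <;> linarith⟩ := 
        Set.projIcc_of_mem _ _
      have h'' : cl (-(2 * (t : ℝ) - 1)) = ⟨-(2 * t - 1), by have := t.2.1; constructor <;> linarith⟩ := 
        Set.projIcc_of_mem _ _
      rw [h', h'']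
      apply Subtype.ext
      simp
    · rw [m2 _ _ ht, abs_of_nonneg (by linarith)]
  obtain ⟨Q, q1, q2, q3⟩ := hep_I hw M
    ⟨fun z => H (w z.1.1, max (cl |2 * (z.1.2 : ℝ) - 1|) z.2), by fun_prop⟩
    (by
      intro x t
      rcases le_total (t : ℝ) (1 / 2) with ht | ht
      · rw [m1 _ _ ht]; simp [g1, hφ]
      · rw [m2 _ _ ht]; simp [h2])
    (by intro a t u; simp [h2, hw.1])
    (by intro a t; simp [mw])
  simp only [ContinuousMap.coe_mk] at q3
  refine ⟨sl G 1, by simp [g1], by simp [g3, h1], ?_⟩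
  have sq := VH.square (p := p) (S := Set.range w) Q p (by simp [q1]) (by simp [q1])
    (by simp [q1]) id 
    (by rintro _ ⟨a, rfl⟩ t; rw [q3, cl_one (by simp), mx, h1]; rfl)
    (by rintro _ ⟨a, rfl⟩ t; rw [q3, cl_one (by norm_num), mx, h1]; rfl)
    (by rintro _ ⟨a, rfl⟩ t; rw [q3, mx', h1]; rfl)
  convert sq using 1
  · ext x
    simp only [sl_apply, q2, ContinuousMap.comp_apply]
    rw [m1 x 0 (by norm_num), cl_zero (by simp)]; simp
  · ext x
    simp only [sl_apply, q2, ContinuousMap.id_apply]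
    rw [m2 x 1 (by norm_num), cl_one (by norm_num)]; simp [h1]

theorem under_left' {r : C(W, B)} {p : C(X, B)} {q : C(Y, B)} {w₁ : C(W, X)} {w₂ : C(W, Y)}
    (hw₁ : IsFibrewiseCofibration r p w₁) (hw₂ : IsFibrewiseCofibration r q w₂)
    (f : C(X, Y)) (hf : ∀ x, q (f x) = p x) (hfw : ∀ a, f (w₁ a) = w₂ a)
    (g : C(Y, X)) (hg : ∀ y, p (g y) = q y)
    (hgf : VH p ∅ (g.comp f) (ContinuousMap.id X)) (hfg : VH q ∅ (f.comp g) (ContinuousMap.id Y)) :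
    ∃ h : C(Y, X), (∀ y, p (h y) = q y) ∧ (∀ a, h (w₂ a) = w₁ a) ∧
      VH p (Set.range w₁) (h.comp f) (ContinuousMap.id X) ∧ VH p ∅ h g := by
  obtain ⟨K, k0, k1, k2, -⟩ := id hgf
  simp only [ContinuousMap.id_apply, ContinuousMap.comp_apply, hg, hf] at k0 k1 k2
  obtain ⟨G, g1, g2, g3⟩ := hw₂.2 X p g ⟨fun y => K (w₁ y.1, y.2), by fun_prop⟩ hg
    (by intro a t; simp [k2, hw₁.1]) (by intro a; simp [k0, hfw])
  simp only [ContinuousMap.coe_mk] at g3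
  have e1 : VH p ∅ g (sl G 1) := ⟨G, g2, by simp, by simp [g1, hg], by simp⟩
  have e2 : VH p ∅ ((sl G 1).comp f) (ContinuousMap.id X) :=
    (e1.symm.pre f ∅ (by simp)).trans hgf
  obtain ⟨ψ, p1, p2, p3⟩ := under_left hw₁ _ (by intro a; simp [hfw, g3, k1]) e2
  refine ⟨ψ.comp (sl G 1), ?_, ?_, p3, ?_⟩
  · intro y; simp [p1, g1]
  · intro a; simp [g3, k1, p2]
  · have a1 := (p3.pre g ∅ (by simp))
    have a2 := hfg.post p (ψ.comp (sl G 1)) (by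
      intro x x' h; simp [p1, g1, h])
    exact a2.symm.trans a1

theorem under_main {r : C(W, B)} {p : C(X, B)} {q : C(Y, B)} {w₁ : C(W, X)} {w₂ : C(W, Y)}
    (hw₁ : IsFibrewiseCofibration r p w₁) (hw₂ : IsFibrewiseCofibration r q w₂)
    (f : C(X, Y)) (hf : ∀ x, q (f x) = p x) (hfw : ∀ a, f (w₁ a) = w₂ a)
    (g : C(Y, X)) (hg : ∀ y, p (g y) = q y)
    (hgf : VH p ∅ (g.comp f) (ContinuousMap.id X)) (hfg : VH q ∅ (f.comp g) (ContinuousMap.id Y)) :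
    IsHtpyEquivOverUnder p q w₁ w₂ f := by
  obtain ⟨h, h1, h2, h3, h4⟩ := under_left' hw₁ hw₂ f hf hfw g hg hgf hfg
  obtain ⟨k, k1, k2, k3, -⟩ := under_left' hw₂ hw₁ h h1 h2 f hf
    ((h4.post q f (by intro x x' h; simp [hf, h])).trans hfg) (h3.mono (by simp))
  have e1 : VH q (Set.range w₁) f k :=
    (k3.pre f (Set.range w₁) (by rintro _ ⟨a, rfl⟩; exact ⟨a, (hfw a).symm⟩)).symm.trans
      (h3.post q k (by intro x x' h; simp [k1, h]))
  have e2 : VH q (Set.range w₂) (f.comp h) (ContinuousMap.id Y) :=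
    (e1.pre h (Set.range w₂) (by rintro _ ⟨a, rfl⟩; exact ⟨a, (h2 a).symm⟩)).trans k3
  refine ⟨hf, hfw, h, h1, h2, ?_, ?_⟩
  · obtain ⟨K, a0, a1, a2, a3⟩ := h3
    refine ⟨K, ?_, ?_, a0, a1⟩
    · intro x t; simp [a2, h1, hf]
    · intro a t; rw [a3 _ ⟨a, rfl⟩]; simp [hfw, h2]
  · obtain ⟨K, a0, a1, a2, a3⟩ := e2
    refine ⟨K, ?_, ?_, a0, a1⟩
    · intro x t; simp [a2, h1, hf]
    · intro a t; rw [a3 _ ⟨a, rfl⟩]; simp [hfw, h2]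

end under

section glue
variable {Z Y ι : Type}

/-- total weight of a list -/
def wt (ρ : ι → Y → ℝ) (l : List ι) (y : Y) : ℝ := (l.map (fun i => ρ i y)).sum

open Classical in
/-- section assembled along a list -/
noncomputable def sec (ρ : ι → Y → ℝ) (S : ι → Y → Z) (D : ι → Z → ℝ → Z) (z₀ : Z) :
    List ι → Y → Z
  | [], _ => z₀
  | i :: l, y => if ρ i y ≤ wt ρ l y then sec ρ S D z₀ l y
      else if 2 * wt ρ l y ≤ ρ i y then S i y
      else D i (sec ρ S D z₀ l y) (2 - 2 * wt ρ l y / ρ i y)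

theorem wt_nonneg {ρ : ι → Y → ℝ} (h : ∀ i y, 0 ≤ ρ i y) (l : List ι) (y : Y) : 0 ≤ wt ρ l y := by
  apply List.sum_nonneg
  simp only [List.mem_map]
  rintro _ ⟨i, -, rfl⟩
  exact h i y

theorem wt_pos {ρ : ι → Y → ℝ} (h : ∀ i y, 0 ≤ ρ i y) (l : List ι) (y : Y) (i : ι) (hi : i ∈ l)
    (hp : 0 < ρ i y) : 0 < wt ρ l y := by
  refine hp.trans_le (List.single_le_sum ?_ _ (List.mem_map.2 ⟨i, hi, rfl⟩))
  simp only [List.mem_map]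
  rintro _ ⟨i, -, rfl⟩
  exact h i y

theorem wt_filter {ρ : ι → Y → ℝ} (l : List ι) (y : Y) (P : ι → Bool)
    (hP : ∀ i, P i = false → ρ i y = 0) : wt ρ (l.filter P) y = wt ρ l y := by
  induction l with
  | nil => rfl
  | cons i l ih =>
    rw [List.filter_cons]
    split_ifs with h
    · simp only [wt, List.map_cons, List.sum_cons] at ih ⊢
      rw [ih]
    · rw [ih]
      simp [wt, hP i (by simpa using h)]

theorem sec_filter {ρ : ι → Y → ℝ} (h0 : ∀ i y, 0 ≤ ρ i y) (S : ι → Y → Z) (D : ι → Z → ℝ → Z)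
    (z₀ : Z) (l : List ι) (y : Y) (P : ι → Bool)
    (hP : ∀ i, P i = false → ρ i y = 0) : sec ρ S D z₀ (l.filter P) y = sec ρ S D z₀ l y := by
  induction l with
  | nil => rfl
  | cons i l ih =>
    rw [List.filter_cons]
    split_ifs with h
    · simp only [sec]
      rw [ih, wt_filter l y P hP]
    · rw [ih]
      have := hP i (by simpa using h)
      rw [sec, if_pos]
      rw [this]
      exact wt_nonneg h0 l y

variable [TopologicalSpace Z] [TopologicalSpace Y]

theorem sec_spec {ρ : ι → Y → ℝ} (h0 : ∀ i y, 0 ≤ ρ i y) (hρ : ∀ i, Continuous (ρ i))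
    (S : ι → Y → Z) (D : ι → Z → ℝ → Z) (z₀ : Z) (π : Z → Y) (U : ι → Set Y)
    (hπ : Continuous π)
    (hU : ∀ i, IsOpen (U i)) (hρU : ∀ i y, 0 < ρ i y → y ∈ U i)
    (hS : ∀ i, ContinuousOn (S i) (U i)) (hSπ : ∀ i, ∀ y ∈ U i, π (S i y) = y)
    (hD : ∀ i, ContinuousOn (fun x : Z × ℝ => D i x.1 x.2) ((π ⁻¹' U i) ×ˢ Set.univ))
    (hDπ : ∀ i z t, π z ∈ U i → π (D i z t) = π z)
    (hD0 : ∀ i z t, π z ∈ U i → t ≤ 0 → D i z t = z)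
    (hD1 : ∀ i z t, π z ∈ U i → 1 ≤ t → D i z t = S i (π z))
    (l : List ι) (y : Y) (hy : 0 < wt ρ l y) :
    π (sec ρ S D z₀ l y) = y ∧ ContinuousAt (sec ρ S D z₀ l) y := by
  have hwt : ∀ l, Continuous (wt ρ l) := by
    intro l
    induction l with
    | nil => exact continuous_const (y := (0 : ℝ))
    | cons i l ih =>
      have : wt ρ (i :: l) = fun y => ρ i y + wt ρ l y := by ext y; simp [wt]
      rw [this]; exact (hρ i).add ih
  induction l generalizing y with
  | nil => simp [wt] at hy
  | cons i l ih =>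
    have hsum : wt ρ (i :: l) y = ρ i y + wt ρ l y := by simp [wt]
    rw [hsum] at hy
    by_cases c1 : ρ i y < wt ρ l y
    · have hl : 0 < wt ρ l y := (h0 i y).trans_lt c1
      obtain ⟨i1, i2⟩ := ih y hl
      constructor
      · rw [sec, if_pos c1.le, i1]
      · refine i2.congr ?_
        filter_upwards [(hρ i).continuousAt.eventually_lt (hwt l).continuousAt c1] with y' hy'
        rw [sec, if_pos hy'.le]
    · have hi : 0 < ρ i y := by
        rcases (h0 i y).lt_or_eq with h | h
        · exact h
        · linarith
      by_cases c2 : 2 * wt ρ l y < ρ i y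
      · constructor
        · rw [sec, if_neg (by have := wt_nonneg h0 l y; linarith), if_pos c2.le,
            hSπ i y (hρU i y hi)]
        · refine ((hS i).continuousAt ((hU i).mem_nhds (hρU i y hi))).congr ?_
          have hc : Continuous fun y => 2 * wt ρ l y := continuous_const.mul (hwt l)
          filter_upwards [hc.continuousAt.eventually_lt (hρ i).continuousAt c2] with y' hy'
          rw [sec, if_neg (by have := wt_nonneg h0 l y'; linarith), if_pos hy'.le]
      · have hl : 0 < wt ρ l y := by linarith
        have key : ∀ y', 0 < wt ρ l y' → 0 < ρ i y' → sec ρ S D z₀ (i :: l) y' =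
            D i (sec ρ S D z₀ l y') (2 - 2 * wt ρ l y' / ρ i y') := by
          intro y' hl' hi'
          have hm : π (sec ρ S D z₀ l y') ∈ U i := by
            rw [(ih y' hl').1]; exact hρU i y' hi'
          rw [sec]
          split_ifs with b1 b2
          · rw [hD0 _ _ _ hm]
            have : 2 ≤ 2 * wt ρ l y' / ρ i y' := by rw [le_div_iff₀ hi']; linarith
            linarith
          · rw [hD1 _ _ _ hm, (ih y' hl').1]
            have : 2 * wt ρ l y' / ρ i y' ≤ 1 := by rw [div_le_iff₀ hi']; linarith
            linarith
          · rfl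
        have hm : π (sec ρ S D z₀ l y) ∈ U i := by
            rw [(ih y hl).1]; exact hρU i y hi
        constructor
        · rw [key y hl hi, hDπ _ _ _ hm, (ih y hl).1]
        · have hcont : ContinuousAt (fun y' => (sec ρ S D z₀ l y', 2 - 2 * wt ρ l y' / ρ i y')) y := by
            refine (ih y hl).2.prodMk ?_
            refine continuousAt_const.sub ?_
            exact ((continuous_const.mul (hwt l)).continuousAt).div (hρ i).continuousAt hi.ne'
          have hD' : ContinuousAt (fun x : Z × ℝ => D i x.1 x.2)
              (sec ρ S D z₀ l y, 2 - 2 * wt ρ l y / ρ i y) :=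
            (hD i).continuousAt ((((hU i).preimage hπ).prod isOpen_univ).mem_nhds ⟨hm, trivial⟩)
          refine (ContinuousAt.comp (f := fun y' => (sec ρ S D z₀ l y', 2 - 2 * wt ρ l y' / ρ i y'))
            hD' hcont).congr ?_
          filter_upwards [(continuousAt_const (y := (0:ℝ))).eventually_lt (hρ i).continuousAt hi,
            (continuousAt_const (y := (0:ℝ))).eventually_lt (hwt l).continuousAt hl] with y' h1 h2
          rw [key y' h2 h1]; rfl

theorem glue {ρ : ι → Y → ℝ} (h0 : ∀ i y, 0 ≤ ρ i y) (hρ : ∀ i, Continuous (ρ i))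
    (hlf : LocallyFinite fun i => Function.support (ρ i)) (hex : ∀ y, ∃ i, 0 < ρ i y)
    (S : ι → Y → Z) (D : ι → Z → ℝ → Z) (z₀ : Z) (π : Z → Y) (U : ι → Set Y)
    (hπ : Continuous π)
    (hU : ∀ i, IsOpen (U i)) (hρU : ∀ i y, 0 < ρ i y → y ∈ U i)
    (hS : ∀ i, ContinuousOn (S i) (U i)) (hSπ : ∀ i, ∀ y ∈ U i, π (S i y) = y)
    (hD : ∀ i, ContinuousOn (fun x : Z × ℝ => D i x.1 x.2) ((π ⁻¹' U i) ×ˢ Set.univ))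
    (hDπ : ∀ i z t, π z ∈ U i → π (D i z t) = π z)
    (hD0 : ∀ i z t, π z ∈ U i → t ≤ 0 → D i z t = z)
    (hD1 : ∀ i z t, π z ∈ U i → 1 ≤ t → D i z t = S i (π z)) :
    ∃ s : C(Y, Z), ∀ y, π (s y) = y := by
  classical
  let _ : LinearOrder ι := linearOrderOfSTO WellOrderingRel
  have hfin : ∀ y, {i | y ∈ Function.support (ρ i)}.Finite := fun y => hlf.point_finite y
  let L : Y → List ι := fun y => (hfin y).toFinset.sort
  have spec := sec_spec h0 hρ S D z₀ π U hπ hU hρU hS hSπ hD hDπ hD0 hD1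
  have hloc : ∀ (F : Finset ι) y, (∀ i, ρ i y ≠ 0 → i ∈ F) →
      sec ρ S D z₀ (L y) y = sec ρ S D z₀ F.sort y := by
    intro F y hF
    rw [← sec_filter h0 S D z₀ (F.sort (fun a b => a ≤ b)) y (fun i => decide (ρ i y ≠ 0)) (by simp)]
    congr 1
    refine List.Perm.eq_of_pairwise' (r := (· ≤ ·)) (Finset.pairwise_sort _ _)
      ((Finset.pairwise_sort _ _).sublist List.filter_sublist) ?_
    rw [List.perm_ext_iff_of_nodup (Finset.sort_nodup _ _) ((Finset.sort_nodup _ _).filter _)]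
    intro i
    simp only [Finset.mem_sort, List.mem_filter, Set.Finite.mem_toFinset, Set.mem_ofPred_eq,
      Function.mem_support, decide_eq_true_eq]
    exact ⟨fun h => ⟨hF i h, h⟩, fun h => h.2⟩
  refine ⟨⟨fun y => sec ρ S D z₀ (L y) y, ?_⟩, ?_⟩
  · rw [continuous_iff_continuousAt]
    intro y
    obtain ⟨N, hN, hfN⟩ := hlf y
    have hF : ∀ y' ∈ N, ∀ i, ρ i y' ≠ 0 → i ∈ hfN.toFinset := by
      intro y' hy' i hi
      rw [Set.Finite.mem_toFinset]
      exact ⟨y', hi, hy'⟩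
    obtain ⟨i, hi⟩ := hex y
    refine (spec hfN.toFinset.sort y (wt_pos h0 _ _ i ?_ hi)).2.congr ?_
    · rw [Finset.mem_sort]; exact hF y (mem_of_mem_nhds hN) i hi.ne'
    · filter_upwards [hN] with y' hy'
      exact (hloc _ y' (hF y' hy')).symm
  · intro y
    obtain ⟨i, hi⟩ := hex y
    exact (spec (L y) y (wt_pos h0 _ _ i (by simp [L, hi.ne']) hi)).1

end glue

section dold
variable {B X Y A : Type} [TopologicalSpace B] [TopologicalSpace X] [TopologicalSpace Y]
  [TopologicalSpace A]

/-- `f` induces a bijection on vertical homotopy classes of lifts of `u` -/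
def BijAt (p : C(X, B)) (q : C(Y, B)) (f : C(X, Y)) (u : C(A, B)) : Prop :=
  (∀ y : C(A, Y), (∀ a, q (y a) = u a) → ∃ x : C(A, X), (∀ a, p (x a) = u a) ∧
    VH q ∅ (f.comp x) y) ∧
  ∀ x x' : C(A, X), (∀ a, p (x a) = u a) → (∀ a, p (x' a) = u a) →
    VH q ∅ (f.comp x) (f.comp x') → VH p ∅ x x'

theorem lift_one {p : C(X, B)} (hp : IsDoldFibration p) (U : C(A × I, B)) (g₁ : C(A, X))
    (h : ∀ a, p (g₁ a) = U (a, 1)) :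
    ∃ g : C(A × I, X), (∀ a t, p (g (a, t)) = U (a, t)) ∧ VH p ∅ (sl g 1) g₁ := by
  obtain ⟨g, h1, h2⟩ := RD.of_dold hp (ContinuousMap.const B ()) A
    ⟨fun x => U (x.1, σ x.2), by fun_prop⟩ g₁ (by simp) (by simp [h])
  refine ⟨⟨fun x => g (x.1, σ x.2), by fun_prop⟩, by intro a t; simp [h1], ?_⟩
  convert h2 using 1
  ext a; simp

theorem lift_zero {p : C(X, B)} (hp : IsDoldFibration p) (U : C(A × I, B)) (g₁ : C(A, X))
    (h : ∀ a, p (g₁ a) = U (a, 0)) :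
    ∃ g : C(A × I, X), (∀ a t, p (g (a, t)) = U (a, t)) ∧ VH p ∅ (sl g 0) g₁ :=
  RD.of_dold hp (ContinuousMap.const B ()) A U g₁ (by simp) h

theorem bij_transport {p : C(X, B)} {q : C(Y, B)} (hp : IsDoldFibration p)
    (hq : IsDoldFibration q) (f : C(X, Y)) (hf : ∀ x, q (f x) = p x) (U : C(A × I, B))
    (h : BijAt p q f (sl U 1)) : BijAt p q f (sl U 0) := by
  have rp := RD.of_dold hp (ContinuousMap.const B ())
  have rq := RD.of_dold hq (ContinuousMap.const B ())
  have hf' : ∀ x x', p x = p x' → q (f x) = q (f x') := by intro x x' h; simp [hf, h]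
  constructor
  · intro y hy
    obtain ⟨G, g1, g2⟩ := lift_zero hq U y hy
    obtain ⟨x₁, x2, x3⟩ := h.1 (sl G 1) (by intro a; simp [g1])
    obtain ⟨H, h1, h2⟩ := lift_one hp U x₁ x2
    refine ⟨sl H 0, by simp [h1], ?_⟩
    have := transport' rq (f.comp H) G (by intro a t; simp [hf, h1, g1]) (by simp)
      ((h2.post q f hf').trans x3)
    exact this.trans g2
  · intro x x' hx hx' hh
    obtain ⟨H, h1, h2⟩ := lift_zero hp U x hx
    obtain ⟨H', h1', h2'⟩ := lift_zero hp U x' hx'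
    have e1 := transport rq (f.comp H) (f.comp H') (by intro a t; simp [hf, h1, h1']) (by simp)
      (((h2.post q f hf').trans hh).trans (h2'.post q f hf').symm)
    have e2 := h.2 (sl H 1) (sl H' 1) (by simp [h1]) (by simp [h1']) e1
    have e3 := transport' rp H H' (by intro a t; simp [h1, h1']) (by simp) e2
    exact (h2.symm.trans e3).trans h2'

/-- mapping path space -/
abbrev PZ (p : C(X, B)) (q : C(Y, B)) (f : C(X, Y)) : Type :=
  {z : X × C(I, Y) // z.2 0 = f z.1 ∧ ∀ t, q (z.2 t) = p z.1}

/-- end point -/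
def pev (p : C(X, B)) (q : C(Y, B)) (f : C(X, Y)) : C(PZ p q f, Y) :=
  ⟨fun z => z.1.2 1, by fun_prop⟩

/-- projection -/
def ppr (p : C(X, B)) (q : C(Y, B)) (f : C(X, Y)) : C(PZ p q f, X) :=
  ⟨fun z => z.1.1, by fun_prop⟩

theorem pz_mk {p : C(X, B)} {q : C(Y, B)} {f : C(X, Y)} (x : C(A, X)) (Φ : C(A × I, Y))
    (h0 : ∀ a, Φ (a, 0) = f (x a)) (h1 : ∀ a t, q (Φ (a, t)) = p (x a)) :
    ∃ z : C(A, PZ p q f), ∀ a, (z a).1.1 = x a ∧ ∀ t, (z a).1.2 t = Φ (a, t) :=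
  ⟨⟨fun a => ⟨(x a, Φ.curry a), h0 a, h1 a⟩,
    Continuous.subtype_mk (by fun_prop) (fun a => ⟨h0 a, h1 a⟩)⟩, fun a => ⟨rfl, fun t => rfl⟩⟩

theorem pz_ext {p : C(X, B)} {q : C(Y, B)} {f : C(X, Y)} {z z' : PZ p q f} (h : z.1.1 = z'.1.1)
    (h' : ∀ t, z.1.2 t = z'.1.2 t) : z = z' :=
  Subtype.ext (Prod.ext h (ContinuousMap.ext h'))

theorem pev_rd (p : C(X, B)) (q : C(Y, B)) (f : C(X, Y)) : RD q (pev p q f) := by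
  intro A _ F g hF hg
  have hg' : ∀ a, (g a).1.2 1 = F (a, 0) := hg
  have hqF : ∀ a t, q (F (a, t)) = p (g a).1.1 := by
    intro a t; rw [hF, ← hg', (g a).2.2]
  have e : ∀ x : (A × I) × I, (x.2 : ℝ) * (1 + x.1.2) = 1 →
      (g x.1.1).1.2 (cl (x.2 * (1 + x.1.2))) = F (x.1.1, cl (x.2 * (1 + x.1.2) - 1)) := by
    intro x hx
    rw [cl_one hx.ge, cl_zero (by linarith), hg']
  let Φ : C((A × I) × I, Y) := ⟨fun x => if (x.2 : ℝ) * (1 + x.1.2) ≤ 1 then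
    (g x.1.1).1.2 (cl (x.2 * (1 + x.1.2))) else F (x.1.1, cl (x.2 * (1 + x.1.2) - 1)),
    Continuous.if_le (by fun_prop) (by fun_prop) (by fun_prop) (by fun_prop) e⟩
  obtain ⟨G, hG⟩ := pz_mk (p := p) (q := q) (f := f) (A := A × I)
    ⟨fun x => (g x.1).1.1, by fun_prop⟩ Φ
    (by rintro ⟨a, t⟩; simp [Φ, cl_zero, (g a).2.1])
    (by
      rintro ⟨a, t⟩ s
      simp only [Φ, ContinuousMap.coe_mk]
      split_ifs
      · rw [(g a).2.2]
      · rw [hqF])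
  have G0 : ∀ a, G (a, 0) = g a := by
    intro a
    refine pz_ext (hG _).1 (fun s => ?_)
    rw [(hG _).2]
    have := s.2.2
    simp [Φ, cl_coe, this]
  refine ⟨G, ?_, ?_⟩
  · intro a t
    show (G (a, t)).1.2 1 = _
    rw [(hG _).2]
    simp only [Φ, ContinuousMap.coe_mk]
    split_ifs with h
    · have ht : t = 0 := by
        apply Subtype.ext
        have := t.2.1
        simp only [Set.Icc.coe_one, one_mul] at h
        simp only [Set.Icc.coe_zero]
        linarith
      subst ht
      rw [cl_one (by simp), hg']
    · congr 2
      simp [cl_coe]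
  · have : sl G 0 = g := by ext1 a; exact G0 a
    rw [this]; exact VH.refl _ _ _

/-- contracting the path coordinate -/
theorem pz_contract {p : C(X, B)} {q : C(Y, B)} {f : C(X, Y)} (hf : ∀ x, q (f x) = p x) :
    ∃ j : C(X, PZ p q f), VH (q.comp (pev p q f)) ∅ (j.comp (ppr p q f)) (ContinuousMap.id _) ∧
      ∀ x, q (pev p q f (j x)) = p x := by
  obtain ⟨j, hj⟩ := pz_mk (p := p) (q := q) (f := f) (ContinuousMap.id X)
    ⟨fun x => f x.1, by fun_prop⟩ (by simp) (by simp [hf])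
  obtain ⟨K, hK⟩ := pz_mk (p := p) (q := q) (f := f) (A := PZ p q f × I)
    ⟨fun x => x.1.1.1, by fun_prop⟩ ⟨fun x => x.1.1.1.2 (x.1.2 * x.2), by fun_prop⟩
    (by rintro ⟨z, t⟩; simp [z.2.1]) (by rintro ⟨z, t⟩ s; simp [z.2.2])
  have qj : ∀ x, q (pev p q f (j x)) = p x := by
    intro x
    show q ((j x).1.2 1) = _
    rw [(hj _).2]; simp [hf]
  refine ⟨j, ⟨K, ?_, ?_, ?_, by simp⟩, qj⟩
  · intro z
    refine pz_ext ?_ (fun t => ?_)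
    · rw [(hK _).1]; exact (hj _).1.symm
    · rw [(hK _).2]
      simp only [ContinuousMap.comp_apply]
      rw [(hj _).2]; simp [z.2.1, ppr]
  · intro z
    refine pz_ext (hK _).1 (fun t => ?_)
    rw [(hK _).2]; simp
  · intro z t
    simp only [ContinuousMap.comp_apply]
    rw [qj]
    show q ((K (z, t)).1.2 1) = _
    rw [(hK _).2]
    simp [z.2.2, ppr]

/-- homotopy from `f ∘ ppr` to `pev` -/
theorem pz_path {p : C(X, B)} {q : C(Y, B)} {f : C(X, Y)} (hf : ∀ x, q (f x) = p x) :
    VH q ∅ (f.comp (ppr p q f)) (pev p q f) := by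
  refine ⟨⟨fun x => x.1.1.2 x.2, by fun_prop⟩, ?_, ?_, ?_, by simp⟩
  · intro z; simp [z.2.1, ppr]
  · intro z; simp [pev]
  · intro z t; simp [z.2.2, ppr, hf]

theorem local_shrink {p : C(X, B)} {q : C(Y, B)} {f : C(X, Y)} (hf : ∀ x, q (f x) = p x)
    (V : Set B)
    (hV : ∀ (A : Type) [TopologicalSpace A] (u : C(A, B)), (∀ a, u a ∈ V) → BijAt p q f u) :
    ∃ s : C({y : Y // q y ∈ V}, PZ p q f), (∀ y, pev p q f (s y) = y.1) ∧
      ∃ D : C({z : PZ p q f // q (pev p q f z) ∈ V} × I, PZ p q f),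
        (∀ z, D (z, 0) = z.1) ∧ (∀ z, D (z, 1) = s ⟨pev p q f z.1, z.2⟩) ∧
        ∀ z t, pev p q f (D (z, t)) = pev p q f z.1 := by
  have hpq : ∀ z : PZ p q f, q (pev p q f z) = p (ppr p q f z) := fun z => z.2.2 1
  let iY : C({y : Y // q y ∈ V}, Y) := ⟨Subtype.val, by fun_prop⟩
  obtain ⟨x, hx, ⟨L, l0, l1, l2, -⟩⟩ := (hV _ (q.comp iY) (fun y => y.2)).1 iY (fun _ => rfl)
  obtain ⟨s, hs⟩ := pz_mk (p := p) (q := q) (f := f) x L l0 (by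
    intro a t; rw [l2]; simp [hf])
  have hsy : ∀ y, pev p q f (s y) = y.1 := by
    intro y; exact ((hs y).2 1).trans (l1 y)
  refine ⟨s, hsy, ?_⟩
  let ZV := {z : PZ p q f // q (pev p q f z) ∈ V}
  let iZ : C(ZV, PZ p q f) := ⟨Subtype.val, by fun_prop⟩
  let πZ : C(ZV, {y : Y // q y ∈ V}) := ⟨fun z => ⟨pev p q f z.1, z.2⟩,
    ((pev p q f).continuous.comp continuous_subtype_val).subtype_mk (fun z => z.2)⟩
  -- the two maps are homotopic over `B`
  have pp := pz_path (p := p) (q := q) (f := f) hf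
  have c1 : VH q ∅ (f.comp ((ppr p q f).comp (s.comp πZ))) (f.comp ((ppr p q f).comp iZ)) := by
    have d1 := pp.pre (s.comp πZ) ∅ (by simp)
    have d2 := pp.pre iZ ∅ (by simp)
    have : (pev p q f).comp (s.comp πZ) = (pev p q f).comp iZ := by
      ext z; exact hsy _
    rw [this] at d1
    exact d1.trans d2.symm
  have c2 : VH p ∅ ((ppr p q f).comp (s.comp πZ)) ((ppr p q f).comp iZ) := by
    refine (hV ZV ((q.comp (pev p q f)).comp iZ) (fun z => z.2)).2 _ _ ?_ ?_ c1
    · intro z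
      show p (ppr p q f (s (πZ z))) = _
      rw [← hpq, hsy]; rfl
    · intro z; exact (hpq _).symm
  obtain ⟨j, hj, qj⟩ := pz_contract (p := p) (q := q) (f := f) hf
  have c3 : VH (q.comp (pev p q f)) ∅ (s.comp πZ) iZ := by
    have d1 := hj.pre (s.comp πZ) ∅ (by simp)
    have d2 := hj.pre iZ ∅ (by simp)
    have d3 := c2.post (q.comp (pev p q f)) j (by
      intro x x' h; simp [qj, h])
    exact (d1.symm.trans d3).trans d2
  obtain ⟨H, h0, h1, h2, -⟩ := c3
  have hqs : ∀ z, q (pev p q f (s (πZ z))) = q (pev p q f z.1) := by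
    intro z; rw [hsy]; rfl
  have hHV : ∀ x : ZV × I, q (pev p q f (H x)) ∈ V := by
    rintro ⟨z, t⟩
    have := h2 z t
    simp only [ContinuousMap.comp_apply] at this
    rw [this, hqs]; exact z.2
  let G : C(ZV × I, PZ p q f) := ⟨fun x => s ⟨pev p q f (H x), hHV x⟩, by fun_prop⟩
  have hpH0 : ∀ z, pev p q f (H (z, 0)) = pev p q f z.1 := by
    intro z; rw [h0]; exact hsy _
  have t1 := transport (pev_rd p q f) G H (by intro z t; exact hsy _)
    (by
      intro z t
      have e1 := h2 z t
      have e2 := h2 z 0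
      simp only [ContinuousMap.comp_apply] at e1 e2
      simp only [G, ContinuousMap.coe_mk, hsy]
      rw [e1, e2])
    (by
      have : sl G 0 = sl H 0 := by
        ext1 z
        have : (⟨pev p q f (H (z, 0)), hHV _⟩ : {y : Y // q y ∈ V}) = πZ z :=
          Subtype.ext (hpH0 z)
        exact (congrArg s this).trans (h0 z).symm
      rw [this]; exact VH.refl _ _ _)
  obtain ⟨D, d0, d1, d2, -⟩ := t1.symm
  refine ⟨D, ?_, ?_, ?_⟩
  · intro z; rw [d0]; exact h1 z
  · intro z; rw [d1]
    simp only [sl_apply, G, ContinuousMap.coe_mk, h1]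
    rfl
  · intro z t; rw [d2]; simp only [sl_apply, h1]; rfl

theorem dold_right {p : C(X, B)} {q : C(Y, B)} {f : C(X, Y)} (hf : ∀ x, q (f x) = p x)
    (hp : IsDoldFibration p) (hq : IsDoldFibration q)
    (hfib : ∀ (A : Type) [TopologicalSpace A] (b : B), BijAt p q f (ContinuousMap.const A b))
    (ι : Type) (V : ι → Set B) (hopen : ∀ i, IsOpen (V i))
    (ρ : PartitionOfUnity ι B) (hsub : ρ.IsSubordinate V)
    (hnull : ∀ i, ∃ (b₀ : B) (N : C(↥(V i) × I, B)),
      (∀ x, N (x, 0) = (x.1 : B)) ∧ (∀ x, N (x, 1) = b₀)) :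
    ∃ g : C(Y, X), (∀ y, p (g y) = q y) ∧ VH q ∅ (f.comp g) (ContinuousMap.id Y) := by
  classical
  have hloc : ∀ i, ∀ (A : Type) [TopologicalSpace A] (u : C(A, B)), (∀ a, u a ∈ V i) →
      BijAt p q f u := by
    intro i A _ u hu
    obtain ⟨b₀, N, n0, n1⟩ := hnull i
    let U : C(A × I, B) := ⟨fun x => N (⟨u x.1, hu _⟩, x.2), by fun_prop⟩
    have e0 : sl U 0 = u := by ext a; simp [U, n0]
    have e1 : sl U 1 = ContinuousMap.const A b₀ := by ext a; simp [U, n1]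
    rw [← e0]
    apply bij_transport hp hq f hf
    rw [e1]
    exact hfib A b₀
  choose s hs D hD0 hD1 hDπ using fun i => local_shrink hf (V i) (hloc i)
  have hsup : ∀ i b, 0 < ρ i b → b ∈ V i := fun i b h =>
    hsub i (subset_tsupport _ (by simpa using h.ne'))
  have hex : ∀ b, ∃ i, 0 < ρ i b := fun b => by
    simpa using ρ.exists_pos (Set.mem_univ b)
  have : ∃ S : C(Y, PZ p q f), ∀ y, pev p q f (S y) = y := by
    rcases isEmpty_or_nonempty Y with hY | ⟨⟨y₀⟩⟩
    · exact ⟨⟨fun y => hY.elim y, continuous_of_const fun y => hY.elim y⟩, fun y => hY.elim y⟩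
    obtain ⟨i₀, hi₀⟩ := hex (q y₀)
    let z₀ : PZ p q f := s i₀ ⟨y₀, hsup _ _ hi₀⟩
    refine glue (ρ := fun i y => ρ i (q y)) (fun i y => ρ.nonneg i _) (fun i => by fun_prop)
      ?_ (fun y => hex (q y))
      (fun i y => if h : q y ∈ V i then s i ⟨y, h⟩ else z₀)
      (fun i z t => if h : q (pev p q f z) ∈ V i then D i (⟨z, h⟩, cl t) else z₀) z₀
      (pev p q f) (fun i => q ⁻¹' V i) (by fun_prop) (fun i => (hopen i).preimage q.continuous)
      (fun i y h => hsup _ _ h) ?_ ?_ ?_ ?_ ?_ ?_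
    · exact ρ.locallyFinite.preimage_continuous q.continuous
    · intro i
      rw [continuousOn_iff_continuous_domRestrict]
      refine (s i).continuous.congr ?_
      intro y
      have : q y.1 ∈ V i := y.2
      simp [this]
    · intro i y hy
      have hy' : q y ∈ V i := hy
      simp [hy', hs]
    · intro i
      rw [continuousOn_iff_continuous_domRestrict]
      have hc : Continuous fun x : ((⇑(pev p q f) ⁻¹' (⇑q ⁻¹' V i)) ×ˢ (Set.univ : Set ℝ) :
          Set (PZ p q f × ℝ)) => D i (⟨x.1.1, x.2.1⟩, cl x.1.2) := by fun_prop
      refine hc.congr ?_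
      intro x
      have : q (pev p q f x.1.1) ∈ V i := x.2.1
      simp [this]
    · intro i z t hz
      have hz' : q (pev p q f z) ∈ V i := hz
      simp [hz', hDπ]
    · intro i z t hz ht
      have hz' : q (pev p q f z) ∈ V i := hz
      simp [hz', cl_zero ht, hD0]
    · intro i z t hz ht
      have hz' : q (pev p q f z) ∈ V i := hz
      simp [hz', cl_one ht, hD1]
  obtain ⟨S, hS⟩ := this
  refine ⟨(ppr p q f).comp S, ?_, ?_⟩
  · intro y
    have := (S y).2.2 1
    rw [show (S y).1.2 1 = y from hS y] at this
    exact this.symm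
  · have := (pz_path (p := p) (q := q) (f := f) hf).pre S ∅ (by simp)
    have e : (pev p q f).comp S = ContinuousMap.id Y := by ext1 y; exact hS y
    rw [e] at this
    exact this

theorem dold {p : C(X, B)} {q : C(Y, B)} {f : C(X, Y)} (hf : ∀ x, q (f x) = p x)
    (hp : IsDoldFibration p) (hq : IsDoldFibration q)
    (hfib : ∀ (A : Type) [TopologicalSpace A] (b : B), BijAt p q f (ContinuousMap.const A b))
    (ι : Type) (V : ι → Set B) (hopen : ∀ i, IsOpen (V i))
    (ρ : PartitionOfUnity ι B) (hsub : ρ.IsSubordinate V)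
    (hnull : ∀ i, ∃ (b₀ : B) (N : C(↥(V i) × I, B)),
      (∀ x, N (x, 0) = (x.1 : B)) ∧ (∀ x, N (x, 1) = b₀)) :
    ∃ g : C(Y, X), (∀ y, p (g y) = q y) ∧ VH p ∅ (g.comp f) (ContinuousMap.id X) ∧
      VH q ∅ (f.comp g) (ContinuousMap.id Y) := by
  obtain ⟨g, hg, hfg⟩ := dold_right hf hp hq hfib ι V hopen ρ hsub hnull
  have pf : ∀ x x', p x = p x' → q (f x) = q (f x') := by intro x x' h; simp [hf, h]
  have pg : ∀ x x', q x = q x' → p (g x) = p (g x') := by intro x x' h; simp [hg, h]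
  have hfib' : ∀ (A : Type) [TopologicalSpace A] (b : B),
      BijAt q p g (ContinuousMap.const A b) := by
    intro A _ b
    constructor
    · intro x hx
      refine ⟨f.comp x, by intro a; simp [hf, hx], ?_⟩
      refine (hfib A b).2 _ _ (by intro a; simp [hf, hg, hx]) hx ?_
      exact hfg.pre (f.comp x) ∅ (by simp)
    · intro y y' hy hy' h
      have h1 := h.post q f pf
      exact ((hfg.pre y ∅ (by simp)).symm.trans h1).trans (hfg.pre y' ∅ (by simp))
  obtain ⟨h, hh, hgh⟩ := dold_right hg hq hp hfib' ι V hopen ρ hsub hnull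
  refine ⟨g, hg, ?_, hfg⟩
  have e1 : VH q ∅ f h := (hgh.post q f pf).symm.trans (hfg.pre h ∅ (by simp))
  exact (e1.post p g pg).trans hgh

end dold

end DoldAux

/-- Let `W`, `X`, `Y` be spaces over `B` with fibrewise maps
`w₁ : W → X`, `w₂ : W → Y` and a map `f : X → Y` over `B` and under `W` such that:
(1) `f` is a homotopy equivalence on each fibre; (2) `B` admits a numerable cover by sets
whose inclusions into `B` are nullhomotopic; (3) `X → B` and `Y → B` are Dold fibrations;
(4) `w₁` and `w₂` are fibrewise cofibrations.  Then `f` is a homotopy equivalence over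
`B` and under `W`. -/
theorem stmt18 {B W X Y : Type} [TopologicalSpace B] [TopologicalSpace W]
    [TopologicalSpace X] [TopologicalSpace Y]
    (r : C(W, B)) (p : C(X, B)) (q : C(Y, B))
    (w₁ : C(W, X)) (w₂ : C(W, Y)) (f : C(X, Y))
    (hover : ∀ x, q (f x) = p x) (hunder : ∀ a, f (w₁ a) = w₂ a)
    -- (1) `f` is a homotopy equivalence on each fibre:
    (hfib : ∀ b : B,
      ∃ (g : C({y : Y // q y = b}, {x : X // p x = b}))
        (K : C({x : X // p x = b} × unitInterval, {x : X // p x = b}))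
        (L : C({y : Y // q y = b} × unitInterval, {y : Y // q y = b})),
        (∀ x : {x : X // p x = b}, (g ⟨f x.1, by rw [hover]; exact x.2⟩ : {x : X // p x = b}) = K (x, 0)) ∧
        (∀ x : {x : X // p x = b}, K (x, 1) = x) ∧
        (∀ y : {y : Y // q y = b}, (⟨f (g y).1, by rw [hover]; exact (g y).2⟩ : {y : Y // q y = b}) = L (y, 0)) ∧
        (∀ y : {y : Y // q y = b}, L (y, 1) = y))
    -- (2) numerable cover with nullhomotopic inclusions:
    (ι : Type) (V : ι → Set B) (hopen : ∀ i, IsOpen (V i))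
    (hcover : ∀ b : B, ∃ i, b ∈ V i)
    (ρ : PartitionOfUnity ι B) (hsub : ρ.IsSubordinate V)
    (hnull : ∀ i, ∃ (b₀ : B) (N : C(↥(V i) × unitInterval, B)),
      (∀ x, N (x, 0) = (x.1 : B)) ∧ (∀ x, N (x, 1) = b₀))
    -- (3) Dold fibrations:
    (hX : IsDoldFibration p) (hY : IsDoldFibration q)
    -- (4) fibrewise cofibrations:
    (hw₁ : IsFibrewiseCofibration r p w₁) (hw₂ : IsFibrewiseCofibration r q w₂) :
    IsHtpyEquivOverUnder p q w₁ w₂ f := by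
  have hB : ∀ (A : Type) [TopologicalSpace A] (b : B),
      DoldAux.BijAt p q f (ContinuousMap.const A b) := by
    intro A _ b
    obtain ⟨g, K, L, h1, h2, h3, h4⟩ := hfib b
    constructor
    · intro y hy
      have hy' : ∀ a, q (y a) = b := hy
      let y' : C(A, {y : Y // q y = b}) := ⟨fun a => ⟨y a, hy' a⟩, by fun_prop⟩
      refine ⟨⟨fun a => (g (y' a)).1, by fun_prop⟩, fun a => (g (y' a)).2,
        ⟨fun x => (L (y' x.1, x.2)).1, by fun_prop⟩, ?_, ?_, ?_, by simp⟩
      · intro a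
        exact (congrArg Subtype.val (h3 (y' a))).symm
      · intro a
        exact congrArg Subtype.val (h4 (y' a))
      · intro a t
        simp only [ContinuousMap.coe_mk, ContinuousMap.comp_apply]
        rw [(L _).2, hover, (g _).2]
    · intro x x' hx hx' hh
      have aux : ∀ (x : C(A, X)) (hx : ∀ a, p (x a) = b) (hfx : ∀ a, q (f (x a)) = b),
          DoldAux.VH p ∅ ⟨fun a => (g ⟨f (x a), hfx a⟩).1, by fun_prop⟩ x := by
        intro x hx hfx
        refine ⟨⟨fun z => (K (⟨x z.1, hx _⟩, z.2)).1, by fun_prop⟩, ?_, ?_, ?_, by simp⟩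
        · intro a
          exact (congrArg Subtype.val (h1 ⟨x a, hx a⟩)).symm
        · intro a
          exact congrArg Subtype.val (h2 ⟨x a, hx a⟩)
        · intro a t
          simp only [ContinuousMap.coe_mk]
          rw [(K _).2, (g _).2]
      have hfx : ∀ a, q (f (x a)) = b := fun a => (hover _).trans (hx a)
      have hfx' : ∀ a, q (f (x' a)) = b := fun a => (hover _).trans (hx' a)
      refine ((aux x hx hfx).symm.trans ?_).trans (aux x' hx' hfx')
      obtain ⟨M, m0, m1, m2, -⟩ := hh
      have mb : ∀ z, q (M z) = b := fun z => (m2 z.1 z.2).trans (hfx z.1)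
      refine ⟨⟨fun z => (g ⟨M z, mb z⟩).1, by fun_prop⟩, ?_, ?_, ?_, by simp⟩
      · intro a; simp [m0]
      · intro a; simp [m1]
      · intro a t
        simp only [ContinuousMap.coe_mk]
        rw [(g _).2, (g _).2]
  obtain ⟨g, hg, hgf, hfg⟩ := DoldAux.dold hover hX hY hB ι V hopen ρ hsub hnull
  exact DoldAux.under_main hw₁ hw₂ f hover hunder g hg hgf hfg
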